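/- There is an absolute constant C with the following property. Let F be a nonzero polynomial in two real variables of degree at most D, where D ≥ 1, and let Z(F) = {z ∈ ℝ² : F(z) = 0} be its zero set. Then for every ρ > 0 and every R > 0, the two-dimensional Lebesgue measure of the intersection of any ball of radius R in ℝ² with the closed ρ-neighborhood of Z(F) is at most C · D · ρ · R. -/

import Mathlib

open MeasureTheory Real Set MvPolynomial

lemma two_mul_finrank_restrictTotalDegree (N : ℕ) :
    2 * Module.finrank ℝ (restrictTotalDegree (Fin 2) ℝ N) = (N + 1) * (N + 2) := by
  let T : Finset (ℕ × ℕ) :=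
    (Finset.range (N + 1)).biUnion (Finset.HasAntidiagonal.antidiagonal (A := ℕ))
  have hT : T.card = ∑ k ∈ Finset.range (N + 1), (k + 1) := by
    rw [Finset.card_biUnion]
    · simp
    · intro i _ j _ hij
      rw [Function.onFun, Finset.disjoint_left]
      intro p hp hp'
      rw [Finset.HasAntidiagonal.mem_antidiagonal] at hp hp'
      omega
  have hcard : Module.finrank ℝ (restrictTotalDegree (Fin 2) ℝ N) = T.card := by
    refine (Module.finrank_eq_nat_card_basis
      (basisRestrictSupport ℝ {n : Fin 2 →₀ ℕ | (n.sum fun _ e => e) ≤ N})).trans ?_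
    rw [← Nat.card_eq_finsetCard]
    refine Nat.card_congr
      (Equiv.subtypeEquiv (Finsupp.equivFunOnFinite.trans (finTwoArrowEquiv ℕ)) fun n => ?_)
    simp [T, Finsupp.sum_fintype, Fin.sum_univ_two]
  rw [hcard, hT]
  clear hcard hT T
  induction N with
  | zero => rfl
  | succ n ih => rw [Finset.sum_range_succ, mul_add, ih]; ring

lemma exists_totalDegree_le_eval_eq (S : Finset (ℝ × ℝ)) (z : ℝ × ℝ) :
    ∃ L : MvPolynomial (Fin 2) ℝ, L.totalDegree ≤ 2 * S.card ∧ eval ![z.1, z.2] L ≠ 0 ∧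
      ∀ w ∈ S, w ≠ z → eval ![w.1, w.2] L = 0 := by
  classical
  let l : ℝ × ℝ → MvPolynomial (Fin 2) ℝ := fun w => (X 0 - C w.1) ^ 2 + (X 1 - C w.2) ^ 2
  have hl : ∀ w, (l w).totalDegree ≤ 2 := by
    intro w
    have key : ∀ (i : Fin 2) (a : ℝ),
        ((X i - C a) ^ 2 : MvPolynomial (Fin 2) ℝ).totalDegree ≤ 2 := by
      intro i a
      refine (totalDegree_pow _ _).trans ?_
      have := totalDegree_sub_C_le (X i : MvPolynomial (Fin 2) ℝ) a
      rw [totalDegree_X] at this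
      omega
    exact (totalDegree_add _ _).trans (max_le (key 0 w.1) (key 1 w.2))
  refine ⟨∏ w ∈ S.erase z, l w, ?_, ?_, ?_⟩
  · refine (totalDegree_finsetProd _ _).trans
      ((Finset.sum_le_card_nsmul _ _ 2 fun w _ => hl w).trans ?_)
    have := Finset.card_erase_le (s := S) (a := z)
    rw [smul_eq_mul]
    omega
  · rw [map_prod, Finset.prod_ne_zero_iff]
    intro w hw h0
    simp only [l, map_add, map_pow, map_sub, eval_X, eval_C, Matrix.cons_val_zero,
      Matrix.cons_val_one] at h0
    apply Finset.ne_of_mem_erase hw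
    ext <;> nlinarith [sq_nonneg (z.1 - w.1), sq_nonneg (z.2 - w.2)]
  · intro w hw hwz
    rw [map_prod]
    refine Finset.prod_eq_zero (Finset.mem_erase.2 ⟨hwz, hw⟩) ?_
    simp [l]

lemma card_common_zeros_le {F G : MvPolynomial (Fin 2) ℝ} (hF : Irreducible F) (hFG : ¬ F ∣ G)
    {e : ℕ} (he : G.totalDegree ≤ e) (S : Finset (ℝ × ℝ))
    (hS : ∀ z ∈ S, eval ![z.1, z.2] F = 0 ∧ eval ![z.1, z.2] G = 0) :
    S.card ≤ F.totalDegree * e := by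
  classical
  set d := F.totalDegree with hd
  set c := 2 * S.card with hc
  let V : ℕ → Submodule ℝ (MvPolynomial (Fin 2) ℝ) := restrictTotalDegree (Fin 2) ℝ
  have hV : ∀ k p, p ∈ V k ↔ p.totalDegree ≤ k := fun k p => mem_restrictTotalDegree _ _ _
  have hVd : ∀ k, 2 * Module.finrank ℝ (V k) = (k + 1) * (k + 2) :=
    two_mul_finrank_restrictTotalDegree
  have : ∀ k, FiniteDimensional ℝ (V k) := fun k =>
    inferInstanceAs (Module.Finite ℝ (restrictTotalDegree (Fin 2) ℝ k))
  let ev : MvPolynomial (Fin 2) ℝ →ₗ[ℝ] (S → ℝ) :=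
    LinearMap.pi fun z => (aeval (R := ℝ) ![z.1.1, z.1.2]).toLinearMap
  have hev : ∀ p z, ev p z = eval ![z.1.1, z.1.2] p := fun p z => by
    simp [ev, aeval_eq_eval]
  let evN := ev.domRestrict (V (c + d + e))
  have hsurj : Function.Surjective evN := by
    rw [← LinearMap.range_eq_top, eq_top_iff, ← (Pi.basisFun ℝ S).span_eq, Submodule.span_le]
    rintro _ ⟨z, rfl⟩
    obtain ⟨L, hL, hLz, hL0⟩ := exists_totalDegree_le_eval_eq S z
    have hmem : (eval ![z.1.1, z.1.2] L)⁻¹ • L ∈ V (c + d + e) :=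
      Submodule.smul_mem _ _ ((hV _ _).2 (by omega))
    refine ⟨⟨_, hmem⟩, ?_⟩
    ext w
    simp only [evN, LinearMap.domRestrict_apply, hev, Pi.basisFun_apply, smul_eval]
    by_cases hwz : w = z
    · subst hwz
      simp [hLz]
    · rw [hL0 w w.2 (fun h => hwz (Subtype.ext h))]
      simp [hwz]
  let Φ : MvPolynomial (Fin 2) ℝ × MvPolynomial (Fin 2) ℝ →ₗ[ℝ] MvPolynomial (Fin 2) ℝ :=
    LinearMap.coprod (LinearMap.mulRight ℝ F) (LinearMap.mulRight ℝ G)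
  have hΦ : ∀ p, Φ p = p.1 * F + p.2 * G := fun p => by simp [Φ]
  let W := (V (c + e)).prod (V (c + d))
  let Ψ := Φ.domRestrict W
  let φ : MvPolynomial (Fin 2) ℝ →ₗ[ℝ] MvPolynomial (Fin 2) ℝ × MvPolynomial (Fin 2) ℝ :=
    LinearMap.prod (-LinearMap.mulRight ℝ G) (LinearMap.mulRight ℝ F)
  have hφ : ∀ p, φ p = (-(p * G), p * F) := fun p => by simp [φ]
  let eW : W ≃ₗ[ℝ] V (c + e) × V (c + d) :=
    { toFun := fun x => (⟨x.1.1, x.2.1⟩, ⟨x.1.2, x.2.2⟩)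
      invFun := fun x => ⟨(x.1.1, x.2.1), x.1.2, x.2.2⟩
      map_add' := fun _ _ => rfl
      map_smul' := fun _ _ => rfl
      left_inv := fun _ => rfl
      right_inv := fun _ => rfl }
  have hWd : Module.finrank ℝ W = Module.finrank ℝ (V (c + e)) + Module.finrank ℝ (V (c + d)) := by
    rw [← Module.finrank_prod]
    exact eW.finrank_eq
  have : FiniteDimensional ℝ W := Module.Finite.equiv eW.symm
  have h1 : Module.finrank ℝ (LinearMap.range Ψ) ≤ Module.finrank ℝ (LinearMap.ker evN) := by
    rw [← Submodule.finrank_map_subtype_eq _ (LinearMap.ker evN)]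
    refine Submodule.finrank_mono ?_
    rintro _ ⟨⟨p, hp⟩, rfl⟩
    obtain ⟨hp1, hp2⟩ := Submodule.mem_prod.1 hp
    rw [hV] at hp1 hp2
    have hmem : Φ p ∈ V (c + d + e) := by
      rw [hV, hΦ]
      refine (totalDegree_add _ _).trans (max_le ?_ ?_) <;>
      · refine (totalDegree_mul _ _).trans ?_
        omega
    refine ⟨⟨Φ p, hmem⟩, ?_, rfl⟩
    ext z
    simp [evN, hev, hΦ, (hS z z.2).1, (hS z z.2).2]
  have h2 : Module.finrank ℝ (LinearMap.ker Ψ) ≤ Module.finrank ℝ (V c) := by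
    rw [← Submodule.finrank_map_subtype_eq _ (LinearMap.ker Ψ)]
    refine le_trans ?_ (Submodule.finrank_map_le φ (V c))
    refine Submodule.finrank_mono ?_
    rintro _ ⟨⟨⟨A, B⟩, hp⟩, hk, rfl⟩
    obtain ⟨hp1, hp2⟩ := Submodule.mem_prod.1 hp
    have hk' : A * F + B * G = 0 := by simpa [Ψ, hΦ] using hk
    have hdvd : F ∣ B * G := ⟨-A, by linear_combination hk'⟩
    obtain ⟨Q, hQ⟩ := (hF.prime.dvd_or_dvd hdvd).resolve_right hFG
    have hF0 := hF.ne_zero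
    have hA : A = -(Q * G) := by
      apply mul_right_cancel₀ hF0
      rw [hQ] at hk'
      linear_combination hk'
    refine ⟨Q, ?_, ?_⟩
    · rw [SetLike.mem_coe, hV]
      by_cases hQ0 : Q = 0
      · simp [hQ0]
      · rw [hV] at hp2
        simp only [hQ] at hp2
        rw [totalDegree_mul_of_isDomain hF0 hQ0] at hp2
        omega
    · rw [hφ]
      simp [hA, hQ, mul_comm F Q]
  have h3 := LinearMap.finrank_range_add_finrank_ker Ψ
  have h4 := LinearMap.finrank_range_add_finrank_ker evN
  rw [LinearMap.range_eq_top.2 hsurj, finrank_top, Module.finrank_fintype_fun_eq_card,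
    Fintype.card_coe] at h4
  have e1 := hVd (c + d + e)
  have e2 := hVd (c + e)
  have e3 := hVd (c + d)
  have e4 := hVd c
  zify at *
  nlinarith

lemma totalDegree_pderiv_lt {F : MvPolynomial (Fin 2) ℝ} {i : Fin 2} (h : pderiv i F ≠ 0) :
    (pderiv i F).totalDegree < F.totalDegree := by
  obtain ⟨m, hm, hdeg⟩ := Finset.exists_mem_eq_sup (pderiv i F).support
    (support_nonempty.2 h) (fun s => s.sum fun _ e => e)
  have hm' : m + Finsupp.single i 1 ∈ F.support := by
    rw [mem_support_iff, coeff_pderiv] at hm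
    rw [mem_support_iff]
    exact left_ne_zero_of_mul hm
  have := le_totalDegree hm'
  rw [Finsupp.sum_add_index' (by simp) (by simp), Finsupp.sum_single_index rfl] at this
  rw [totalDegree, hdeg]
  omega

lemma not_dvd_pderiv {F : MvPolynomial (Fin 2) ℝ} {i : Fin 2} (h : pderiv i F ≠ 0) :
    ¬ F ∣ pderiv i F := by
  rintro ⟨Q, hQ⟩
  have hlt := totalDegree_pderiv_lt h
  rw [hQ] at h hlt
  rw [totalDegree_mul_of_isDomain (left_ne_zero_of_mul h) (right_ne_zero_of_mul h)] at hlt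
  omega

/-- If every finite set of common zeros is small, then so is the set of all of them. -/
lemma exists_finset_card_le_of_forall_subset {α : Type*} {P : α → Prop} {m : ℕ}
    (h : ∀ S : Finset α, (∀ z ∈ S, P z) → S.card ≤ m) :
    ∃ S : Finset α, S.card ≤ m ∧ ∀ z, P z → z ∈ S := by
  have hfin : {z | P z}.Finite := by
    by_contra hinf
    obtain ⟨S, hS, hcard⟩ := Set.Infinite.exists_subset_card_eq hinf (m + 1)
    have := h S fun z hz => hS hz
    omega
  refine ⟨hfin.toFinset, h _ fun z hz => by simpa using hz, fun z hz => by simpa using hz⟩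

lemma continuous_eval_pair (F : MvPolynomial (Fin 2) ℝ) :
    Continuous fun z : ℝ × ℝ => eval ![z.1, z.2] F :=
  (continuous_eval F).comp (by fun_prop)

lemma hasDerivAt_eval_snd (F : MvPolynomial (Fin 2) ℝ) (x y : ℝ) :
    HasDerivAt (fun y => eval ![x, y] F) (eval ![x, y] (pderiv 1 F)) y := by
  induction F using MvPolynomial.induction_on with
  | C a => simpa using hasDerivAt_const y a
  | add p q hp hq =>
    simp only [map_add]
    exact hp.add hq
  | mul_X p i hp =>
    have hX : HasDerivAt (fun y => eval ![x, y] (X i : MvPolynomial (Fin 2) ℝ))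
        (eval ![x, y] (pderiv 1 (X i : MvPolynomial (Fin 2) ℝ))) y := by
      fin_cases i
      · simpa using hasDerivAt_const y x
      · simpa using hasDerivAt_id' y
    simp only [pderiv_mul, map_add, map_mul]
    exact hp.mul hX

lemma exists_mul_neg_of_hasDerivAt {f : ℝ → ℝ} {f' y c e : ℝ} (hf : HasDerivAt f f' y)
    (hf' : f' ≠ 0) (hy : f y = 0) (hc : c < y) (he : y < e) :
    ∃ y₁ ∈ Ioo c y, ∃ y₂ ∈ Ioo y e, f y₁ * f y₂ < 0 := by
  have main : ∀ {g : ℝ → ℝ} {g' : ℝ}, HasDerivAt g g' y → 0 < g' → g y = 0 →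
      ∃ y₁ ∈ Ioo c y, ∃ y₂ ∈ Ioo y e, g y₁ * g y₂ < 0 := by
    intro g g' hg hg' hgy
    have hs := eventually_nhdsWithin_sign_eq_of_deriv_pos (by rwa [hg.deriv]) hgy
    obtain ⟨y₁, h₁, hy₁⟩ := ((hs.filter_mono nhdsWithin_le_nhds).and
      (Ioo_mem_nhdsLT hc)).exists
    obtain ⟨y₂, h₂, hy₂⟩ := ((hs.filter_mono nhdsWithin_le_nhds).and
      (Ioo_mem_nhdsGT he)).exists
    refine ⟨y₁, hy₁, y₂, hy₂, ?_⟩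
    rw [sign_neg (sub_neg.2 hy₁.2), sign_eq_neg_one_iff] at h₁
    rw [sign_pos (sub_pos.2 hy₂.1), sign_eq_one_iff] at h₂
    exact mul_neg_of_neg_of_pos h₁ h₂
  rcases hf'.lt_or_gt with h | h
  · obtain ⟨y₁, h₁, y₂, h₂, h₁₂⟩ := main hf.neg (neg_pos.2 h) (by simp [hy])
    exact ⟨y₁, h₁, y₂, h₂, by simpa using h₁₂⟩
  · exact main hf h hy

/-- A zero set meeting a rectangle either meets its boundary or has, inside it, a point with
vertical tangent, namely a rightmost point. -/
lemma exists_edge_zero_or_critical_zero {f f' : ℝ × ℝ → ℝ} (hf : Continuous f)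
    (hf' : ∀ x y, HasDerivAt (fun y => f (x, y)) (f' (x, y)) y) {a b c e : ℝ}
    (h : ∃ z ∈ Icc a b ×ˢ Icc c e, f z = 0) :
    (∃ z ∈ Icc a b ×ˢ Icc c e, f z = 0 ∧ ((z.1 = a ∨ z.1 = b) ∨ (z.2 = c ∨ z.2 = e))) ∨
    ∃ z ∈ Ioo a b ×ˢ Ioo c e, f z = 0 ∧ f' z = 0 := by
  rw [or_iff_not_imp_left]
  intro hedge
  have hcomp : IsCompact ((Icc a b ×ˢ Icc c e) ∩ {z : ℝ × ℝ | f z = 0}) :=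
    (isCompact_Icc.prod isCompact_Icc).inter_right (isClosed_eq hf continuous_const)
  obtain ⟨⟨p, q⟩, ⟨hp, hp0⟩, hmax⟩ := hcomp.exists_isMaxOn h continuous_fst.continuousOn
  replace hp0 : f (p, q) = 0 := hp0
  have hne : ¬((p = a ∨ p = b) ∨ (q = c ∨ q = e)) := fun h' => hedge ⟨(p, q), hp, hp0, h'⟩
  push Not at hne
  obtain ⟨⟨h1, h2⟩, h3, h4⟩ := hne
  obtain ⟨⟨ha, hb⟩, hc, he⟩ := hp
  replace ha : a < p := lt_of_le_of_ne ha h1.symm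
  replace hb : p < b := lt_of_le_of_ne hb h2
  replace hc : c < q := lt_of_le_of_ne hc h3.symm
  replace he : q < e := lt_of_le_of_ne he h4
  refine ⟨(p, q), ⟨⟨ha, hb⟩, hc, he⟩, hp0, ?_⟩
  by_contra hd
  obtain ⟨y₁, hy₁, y₂, hy₂, hneg⟩ := exists_mul_neg_of_hasDerivAt (hf' p q) hd hp0 hc he
  have hcont : ∀ y, Continuous fun x : ℝ => f (x, y) := fun y => hf.comp (by fun_prop)
  have hev : ∀ᶠ x in nhds p, f (x, y₁) * f (x, y₂) < 0 :=
    ((hcont y₁).mul (hcont y₂)).continuousAt.eventually_lt continuousAt_const hneg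
  obtain ⟨x, hx, hxp, hxb⟩ := ((hev.filter_mono nhdsWithin_le_nhds).and
    (Ioo_mem_nhdsGT hb)).exists
  have hcont' : Continuous fun y : ℝ => f (x, y) := hf.comp (by fun_prop)
  have hzero : (0 : ℝ) ∈ uIcc (f (x, y₁)) (f (x, y₂)) := by
    rw [mem_uIcc]
    rcases mul_neg_iff.1 hx with h | h
    · exact Or.inr ⟨h.2.le, h.1.le⟩
    · exact Or.inl ⟨h.1.le, h.2.le⟩
  obtain ⟨y, hy, hy0⟩ := intermediate_value_uIcc hcont'.continuousOn hzero
  rw [uIcc_of_le (hy₁.2.trans hy₂.1).le] at hy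
  have hmem : (x, y) ∈ (Icc a b ×ˢ Icc c e) ∩ {z : ℝ × ℝ | f z = 0} :=
    ⟨⟨⟨(ha.trans hxp).le, hxb.le⟩, hy₁.1.le.trans hy.1, hy.2.trans hy₂.2.le⟩, hy0⟩
  exact absurd hxp (not_lt.2 (isMaxOn_iff.1 hmax _ hmem))

lemma exists_finset_forall_edge_zero_or_mem {F : MvPolynomial (Fin 2) ℝ} (hF : Irreducible F) :
    ∃ S : Finset (ℝ × ℝ), S.card ≤ F.totalDegree * F.totalDegree ∧ ∀ a b c e : ℝ,
      (∃ z ∈ Icc a b ×ˢ Icc c e, eval ![z.1, z.2] F = 0) →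
      (∃ z ∈ Icc a b ×ˢ Icc c e, eval ![z.1, z.2] F = 0 ∧
        ((z.1 = a ∨ z.1 = b) ∨ (z.2 = c ∨ z.2 = e))) ∨
      ∃ z ∈ S, z ∈ Ioo a b ×ˢ Ioo c e := by
  by_cases hd : pderiv 1 F = 0
  · refine ⟨∅, by simp, ?_⟩
    rintro a b c e ⟨z, ⟨hz1, hz2⟩, hz⟩
    refine Or.inl ⟨(z.1, c), ⟨hz1, left_mem_Icc.2 (hz2.1.trans hz2.2)⟩, ?_, by simp⟩
    have hder : ∀ y, HasDerivAt (fun y => eval ![z.1, y] F) 0 y := fun y => by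
      simpa [hd] using hasDerivAt_eval_snd F z.1 y
    rw [← hz]
    exact is_const_of_deriv_eq_zero (fun y => (hder y).differentiableAt)
      (fun y => (hder y).deriv) c z.2
  · obtain ⟨S, hS, hmem⟩ := exists_finset_card_le_of_forall_subset fun S hS =>
      card_common_zeros_le hF (not_dvd_pderiv hd) (totalDegree_pderiv_lt hd).le S hS
    refine ⟨S, hS, fun a b c e h => ?_⟩
    exact (exists_edge_zero_or_critical_zero (f' := fun z => eval ![z.1, z.2] (pderiv 1 F))
      (continuous_eval_pair F) (hasDerivAt_eval_snd F) h).imp_right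
        fun ⟨z, hz, hz0⟩ => ⟨z, hmem z hz0, hz⟩

lemma exists_finset_roots {F : MvPolynomial (Fin 2) ℝ} (v : Fin 2 → Polynomial ℝ)
    (hv : ∀ i, (v i).natDegree ≤ 1) (h : ∃ y, eval (fun i => (v i).eval y) F ≠ 0) :
    ∃ S : Finset ℝ, S.card ≤ F.totalDegree ∧
      ∀ y, eval (fun i => (v i).eval y) F = 0 → y ∈ S := by
  have heval : ∀ y, (aeval v F).eval y = eval (fun i => (v i).eval y) F := fun y => by
    rw [aeval_def, ← Polynomial.coe_evalRingHom, hom_eval₂, ← eval₂_id]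
    congr 1
    ext
    simp
  have hne : aeval v F ≠ 0 := by
    obtain ⟨y, hy⟩ := h
    rintro h0
    rw [← heval, h0, Polynomial.eval_zero] at hy
    exact hy rfl
  refine ⟨(aeval v F).roots.toFinset, ?_, fun y hy => ?_⟩
  · have := aeval_natDegree_le F le_rfl v hv
    exact (Multiset.toFinset_card_le _).trans ((Polynomial.card_roots' _).trans (by omega))
  · rw [Multiset.mem_toFinset, Polynomial.mem_roots hne, Polynomial.IsRoot, heval, hy]

lemma exists_finset_roots_snd {F : MvPolynomial (Fin 2) ℝ} (a : ℝ)
    (h : ∃ y, eval ![a, y] F ≠ 0) :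
    ∃ S : Finset ℝ, S.card ≤ F.totalDegree ∧ ∀ y, eval ![a, y] F = 0 → y ∈ S := by
  have hv : ∀ y : ℝ, (fun i => ((![Polynomial.C a, Polynomial.X] : Fin 2 → Polynomial ℝ) i).eval y)
      = ![a, y] := fun y => by
    ext i; fin_cases i <;> simp
  have := exists_finset_roots (F := F) ![Polynomial.C a, Polynomial.X]
    (fun i => by fin_cases i <;> simp)
  simp only [hv] at this
  exact this h

lemma exists_finset_roots_fst {F : MvPolynomial (Fin 2) ℝ} (b : ℝ)
    (h : ∃ x, eval ![x, b] F ≠ 0) :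
    ∃ S : Finset ℝ, S.card ≤ F.totalDegree ∧ ∀ x, eval ![x, b] F = 0 → x ∈ S := by
  have hv : ∀ x : ℝ, (fun i => ((![Polynomial.X, Polynomial.C b] : Fin 2 → Polynomial ℝ) i).eval x)
      = ![x, b] := fun y => by
    ext i; fin_cases i <;> simp
  have := exists_finset_roots (F := F) ![Polynomial.X, Polynomial.C b]
    (fun i => by fin_cases i <;> simp)
  simp only [hv] at this
  exact this h

lemma exists_offset (A : Finset ℝ) (ρ : ℝ) {u v : ℝ} (huv : u < v) :
    ∃ s ∈ Ioo u v, ∀ k : ℕ, s + k * ρ ∉ A := by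
  have hc : (⋃ k : ℕ, (fun s : ℝ => s + k * ρ) ⁻¹' (A : Set ℝ)).Countable :=
    countable_iUnion fun k =>
      A.countable_toSet.preimage_of_injOn (add_left_injective _).injOn
  obtain ⟨s, hs, hsuv⟩ := (hc.dense_compl ℝ).exists_between huv
  refine ⟨s, hsuv, fun k hk => hs (mem_iUnion.2 ⟨k, hk⟩)⟩

lemma volume_ball_le {ρ R d : ℝ} (hd : R ≤ d * ρ) (hR : 0 < R) (x₀ : ℝ × ℝ) :
    volume (Metric.ball x₀ R) ≤ ENNReal.ofReal (2000 * d * ρ * R) := by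
  rw [← ball_prod_same, Measure.volume_eq_prod, Measure.prod_prod, Real.volume_ball,
    Real.volume_ball, ← ENNReal.ofReal_mul (by positivity)]
  refine ENNReal.ofReal_le_ofReal ?_
  nlinarith [mul_le_mul_of_nonneg_right hd hR.le, mul_pos hR hR]

/-- The grid lines `x = s + kρ` and `y = t + kρ`, `k ≤ n`, meet the zero set in few points, if
none of them is contained in it. -/
lemma exists_finset_grid_zeros {F : MvPolynomial (Fin 2) ℝ} {s t ρ : ℝ}
    (hs : ∀ k : ℕ, ∃ y, eval ![s + k * ρ, y] F ≠ 0)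
    (ht : ∀ k : ℕ, ∃ x, eval ![x, t + k * ρ] F ≠ 0) (n : ℕ) :
    ∃ W : Finset (ℝ × ℝ), W.card ≤ (n + 1) * (2 * F.totalDegree) ∧
      ∀ z : ℝ × ℝ, eval ![z.1, z.2] F = 0 → ∀ k ≤ n,
        (z.1 = s + k * ρ ∨ z.2 = t + k * ρ) → z ∈ W := by
  classical
  choose A hA hA' using fun k => exists_finset_roots_snd _ (hs k)
  choose B hB hB' using fun k => exists_finset_roots_fst _ (ht k)
  refine ⟨(Finset.range (n + 1)).biUnion fun k =>
    (A k).image (fun y => (s + k * ρ, y)) ∪ (B k).image (fun x => (x, t + k * ρ)), ?_, ?_⟩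
  · refine (Finset.card_biUnion_le_card_mul _ _ (2 * F.totalDegree) fun k _ => ?_).trans
      (by rw [Finset.card_range])
    have h1 := Finset.card_union_le ((A k).image fun y => (s + k * ρ, y))
      ((B k).image fun x => (x, t + k * ρ))
    have h2 := Finset.card_image_le (s := A k) (f := fun y => (s + k * ρ, y))
    have h3 := Finset.card_image_le (s := B k) (f := fun x => (x, t + k * ρ))
    have := hA k
    have := hB k
    omega
  · rintro ⟨x, y⟩ hz k hk hzk
    simp only [Finset.mem_biUnion, Finset.mem_range, Finset.mem_union, Finset.mem_image]
    refine ⟨k, Nat.lt_succ_of_le hk, ?_⟩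
    rcases hzk with rfl | rfl
    · exact Or.inl ⟨y, hA' k y hz, rfl⟩
    · exact Or.inr ⟨x, hB' k x hz, rfl⟩

lemma exists_sub_floor_eq {x s ρ : ℝ} (hρ : 0 < ρ) {i : ℕ}
    (hx : x ∈ Icc (s + i * ρ) (s + (i + 1 : ℕ) * ρ)) :
    ∃ a ∈ Finset.range 2, ⌊(x - s) / ρ⌋₊ - a = i := by
  have h1 : i ≤ ⌊(x - s) / ρ⌋₊ := Nat.le_floor (by rw [le_div_iff₀ hρ]; linarith [hx.1])
  have h2 : ⌊(x - s) / ρ⌋₊ ≤ i + 1 :=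
    Nat.floor_le_of_le (by rw [div_le_iff₀ hρ]; linarith [hx.2])
  exact ⟨⌊(x - s) / ρ⌋₊ - i, Finset.mem_range.2 (by omega), by omega⟩

lemma floor_eq_of_mem_Ioo {x s ρ : ℝ} (hρ : 0 < ρ) {i : ℕ}
    (hx : x ∈ Ioo (s + i * ρ) (s + (i + 1 : ℕ) * ρ)) : ⌊(x - s) / ρ⌋₊ = i := by
  have h := hx.2
  push_cast at h
  have h0 : (i : ℝ) ≤ (x - s) / ρ := by
    rw [le_div_iff₀ hρ]
    linarith [hx.1]
  rw [Nat.floor_eq_iff (i.cast_nonneg.trans h0), div_lt_iff₀ hρ]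
  exact ⟨h0, by linarith⟩

lemma mem_Icc_floor {x s ρ : ℝ} (hρ : 0 < ρ) (hx : s ≤ x) :
    x ∈ Icc (s + ⌊(x - s) / ρ⌋₊ * ρ) (s + (⌊(x - s) / ρ⌋₊ + 1 : ℕ) * ρ) := by
  have h1 := Nat.floor_le (div_nonneg (sub_nonneg.2 hx) hρ.le)
  have h2 := (Nat.lt_floor_add_one ((x - s) / ρ)).le
  rw [le_div_iff₀ hρ] at h1
  rw [div_le_iff₀ hρ] at h2
  push_cast
  exact ⟨by linarith, by linarith⟩

/-- The number of cells of an `n × n` grid which are met by an irreducible curve of degree `d` is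
`O(nd + d²)`. -/
lemma exists_finset_cells {F : MvPolynomial (Fin 2) ℝ} (hF : Irreducible F) {s t ρ : ℝ}
    (hρ : 0 < ρ) (hs : ∀ k : ℕ, ∃ y, eval ![s + k * ρ, y] F ≠ 0)
    (ht : ∀ k : ℕ, ∃ x, eval ![x, t + k * ρ] F ≠ 0) (n : ℕ) :
    ∃ T : Finset (ℕ × ℕ),
      T.card ≤ (n + 1) * (2 * F.totalDegree) * 4 + F.totalDegree * F.totalDegree ∧
      ∀ z ∈ Ico s (s + n * ρ) ×ˢ Ico t (t + n * ρ), eval ![z.1, z.2] F = 0 →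
        (⌊(z.1 - s) / ρ⌋₊, ⌊(z.2 - t) / ρ⌋₊) ∈ T := by
  classical
  obtain ⟨S, hS, hmem⟩ := exists_finset_forall_edge_zero_or_mem hF
  obtain ⟨W, hW, hmemW⟩ := exists_finset_grid_zeros hs ht n
  let cell : ℝ × ℝ → ℕ × ℕ := fun z => (⌊(z.1 - s) / ρ⌋₊, ⌊(z.2 - t) / ρ⌋₊)
  refine ⟨(W ×ˢ (Finset.range 2 ×ˢ Finset.range 2)).image
      (fun q => ((cell q.1).1 - q.2.1, (cell q.1).2 - q.2.2)) ∪ S.image cell, ?_, ?_⟩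
  · refine (Finset.card_union_le _ _).trans (add_le_add ?_ (Finset.card_image_le.trans hS))
    refine Finset.card_image_le.trans ?_
    simp only [Finset.card_product, Finset.card_range]
    exact Nat.mul_le_mul_right 4 hW
  · rintro z ⟨hz1, hz2⟩ hz
    have hlt : ∀ {x u : ℝ}, x ∈ Ico u (u + n * ρ) → ⌊(x - u) / ρ⌋₊ < n := fun {x u} hx => by
      rw [Nat.floor_lt (div_nonneg (sub_nonneg.2 hx.1) hρ.le), div_lt_iff₀ hρ]
      linarith [hx.2]
    have hi := hlt hz1
    have hj := hlt hz2
    have m1 := mem_Icc_floor hρ hz1.1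
    have m2 := mem_Icc_floor hρ hz2.1
    generalize ⌊(z.1 - s) / ρ⌋₊ = i at *
    generalize ⌊(z.2 - t) / ρ⌋₊ = j at *
    rw [Finset.mem_union, Finset.mem_image, Finset.mem_image]
    rcases hmem _ _ _ _ ⟨z, ⟨m1, m2⟩, hz⟩ with ⟨w, ⟨hw1, hw2⟩, hw, hedge⟩ | ⟨w, hwS, hw1, hw2⟩
    · left
      obtain ⟨a, ha, hai⟩ := exists_sub_floor_eq hρ hw1
      obtain ⟨b, hb, hbj⟩ := exists_sub_floor_eq hρ hw2
      refine ⟨(w, a, b), ?_, Prod.ext hai hbj⟩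
      rw [Finset.mem_product, Finset.mem_product]
      refine ⟨?_, ha, hb⟩
      rcases hedge with (h | h) | (h | h)
      · exact hmemW w hw i hi.le (Or.inl h)
      · exact hmemW w hw (i + 1) hi (Or.inl h)
      · exact hmemW w hw j hj.le (Or.inr h)
      · exact hmemW w hw (j + 1) hj (Or.inr h)
    · right
      exact ⟨w, hwS, Prod.ext (floor_eq_of_mem_Ioo hρ hw1) (floor_eq_of_mem_Ioo hρ hw2)⟩

lemma exists_generic_grid {F : MvPolynomial (Fin 2) ℝ} (hF : F ≠ 0) (ρ : ℝ) {u u' v v' : ℝ}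
    (hu : u < u') (hv : v < v') :
    ∃ s ∈ Ioo u u', ∃ t ∈ Ioo v v', (∀ k : ℕ, ∃ y, eval ![s + k * ρ, y] F ≠ 0) ∧
      ∀ k : ℕ, ∃ x, eval ![x, t + k * ρ] F ≠ 0 := by
  obtain ⟨p, hp⟩ : ∃ p, eval p F ≠ 0 := by
    by_contra! h
    exact hF (MvPolynomial.funext fun p => by simp [h p])
  have hp' : eval ![p 0, p 1] F ≠ 0 := by
    rwa [show ![p 0, p 1] = p by ext i; fin_cases i <;> rfl]
  obtain ⟨A, -, hA⟩ := exists_finset_roots_fst (p 1) ⟨_, hp'⟩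
  obtain ⟨B, -, hB⟩ := exists_finset_roots_snd (p 0) ⟨_, hp'⟩
  obtain ⟨s, hs, hsA⟩ := exists_offset A ρ hu
  obtain ⟨t, ht, htB⟩ := exists_offset B ρ hv
  exact ⟨s, hs, t, ht, fun k => ⟨p 1, fun h => hsA k (hA _ h)⟩,
    fun k => ⟨p 0, fun h => htB k (hB _ h)⟩⟩

lemma volume_ball_inter_cthickening_le_of_irreducible {F : MvPolynomial (Fin 2) ℝ}
    (hF : Irreducible F) {ρ R : ℝ} (hρ : 0 < ρ) (hR : 0 < R) (x₀ : ℝ × ℝ) :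
    volume (Metric.ball x₀ R ∩
      Metric.cthickening ρ {z : ℝ × ℝ | eval ![z.1, z.2] F = 0}) ≤
        ENNReal.ofReal (2000 * F.totalDegree * ρ * R) := by
  rcases le_or_gt R (F.totalDegree * ρ) with hle | hlt
  · exact (measure_mono inter_subset_left).trans (volume_ball_le hle hR x₀)
  have hd : 1 ≤ F.totalDegree := by
    by_contra! h
    have hC := totalDegree_eq_zero_iff_eq_C.1 (Nat.lt_one_iff.1 h)
    refine hF.not_isUnit ?_
    rw [hC]
    refine IsUnit.map C (isUnit_iff_ne_zero.2 fun h0 => hF.ne_zero ?_)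
    rw [hC, h0, C_0]
  obtain ⟨s, hs, t, ht, hsF, htF⟩ := exists_generic_grid hF.ne_zero ρ
    (u := x₀.1 - R - 3 * ρ) (u' := x₀.1 - R - 2 * ρ)
    (v := x₀.2 - R - 3 * ρ) (v' := x₀.2 - R - 2 * ρ) (by linarith) (by linarith)
  set n := ⌈(2 * R + 5 * ρ) / ρ⌉₊ with hn
  have hn1 : 2 * R + 5 * ρ ≤ n * ρ := (div_le_iff₀ hρ).1 (Nat.le_ceil _)
  have hn2 : n * ρ < 2 * R + 6 * ρ := by
    have := Nat.ceil_lt_add_one (a := (2 * R + 5 * ρ) / ρ) (by positivity)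
    rw [← hn, ← sub_lt_iff_lt_add, lt_div_iff₀ hρ] at this
    linarith
  obtain ⟨T, hT, hmem⟩ := exists_finset_cells hF hρ hsF htF n
  let E : ℕ → ℝ → Set ℝ := fun i u => Icc (u + i * ρ - 2 * ρ) (u + (i + 1 : ℕ) * ρ + 2 * ρ)
  have hE : ∀ i u, volume (E i u) = ENNReal.ofReal (5 * ρ) := fun i u => by
    rw [Real.volume_Icc]
    congr 1
    push_cast
    ring
  have hcover : Metric.ball x₀ R ∩ Metric.cthickening ρ {z : ℝ × ℝ | eval ![z.1, z.2] F = 0} ⊆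
      ⋃ c ∈ T, E c.1 s ×ˢ E c.2 t := by
    rintro p ⟨hp, hpZ⟩
    have hpZ' := Metric.cthickening_subset_thickening' (by linarith : 0 < 2 * ρ)
      (by linarith : ρ < 2 * ρ) _ hpZ
    obtain ⟨z, hz, hpz⟩ := Metric.mem_thickening_iff.1 hpZ'
    rw [Metric.mem_ball, Prod.dist_eq, max_lt_iff, Real.dist_eq, Real.dist_eq, abs_lt, abs_lt] at hp
    rw [Prod.dist_eq, max_lt_iff, Real.dist_eq, Real.dist_eq, abs_lt, abs_lt] at hpz
    obtain ⟨⟨_, _⟩, _, _⟩ := hp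
    obtain ⟨⟨_, _⟩, _, _⟩ := hpz
    obtain ⟨_, _⟩ := hs
    obtain ⟨_, _⟩ := ht
    have hz1 : z.1 ∈ Ico s (s + n * ρ) := ⟨by linarith, by linarith⟩
    have hz2 : z.2 ∈ Ico t (t + n * ρ) := ⟨by linarith, by linarith⟩
    have m1 := mem_Icc_floor hρ hz1.1
    have m2 := mem_Icc_floor hρ hz2.1
    refine mem_biUnion (hmem z ⟨hz1, hz2⟩ hz)
      ⟨⟨?_, ?_⟩, ?_, ?_⟩ <;> linarith [m1.1, m1.2, m2.1, m2.2]
  refine (measure_mono hcover).trans ((measure_biUnion_finset_le _ _).trans ?_)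
  simp only [Measure.volume_eq_prod, Measure.prod_prod, hE, Finset.sum_const, nsmul_eq_mul]
  rw [← ENNReal.ofReal_mul (by positivity), ← ENNReal.ofReal_natCast,
    ← ENNReal.ofReal_mul (by positivity)]
  refine ENNReal.ofReal_le_ofReal ?_
  have hT' : (T.card : ℝ) ≤
      (n + 1) * (2 * F.totalDegree) * 4 + F.totalDegree * F.totalDegree := by
    exact_mod_cast hT
  have hd' : (1 : ℝ) ≤ F.totalDegree := by exact_mod_cast hd
  generalize (F.totalDegree : ℝ) = d at *
  have hρR : ρ ≤ R := by nlinarith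
  have hcard : T.card * ρ ≤ 73 * (d * R) := by
    have h1 : (n + 1) * ρ ≤ 9 * R := by linarith
    nlinarith [mul_le_mul_of_nonneg_left h1 (by linarith : 0 ≤ d),
      mul_le_mul_of_nonneg_left hlt.le (by linarith : 0 ≤ d),
      mul_le_mul_of_nonneg_right hT' hρ.le]
  nlinarith [mul_le_mul_of_nonneg_right hcard hρ.le, mul_pos (mul_pos (by linarith : 0 < d) hρ) hR]

lemma volume_ball_inter_cthickening_le {F : MvPolynomial (Fin 2) ℝ} (hF : F ≠ 0) {ρ R : ℝ}
    (hρ : 0 < ρ) (hR : 0 < R) (x₀ : ℝ × ℝ) :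
    volume (Metric.ball x₀ R ∩
      Metric.cthickening ρ {z : ℝ × ℝ | eval ![z.1, z.2] F = 0}) ≤
        ENNReal.ofReal (2000 * F.totalDegree * ρ * R) := by
  induction F using WfDvdMonoid.induction_on_irreducible with
  | zero => exact absurd rfl hF
  | unit u hu =>
    have : {z : ℝ × ℝ | eval ![z.1, z.2] u = 0} = ∅ :=
      eq_empty_of_forall_notMem fun z hz => (hu.map (eval ![z.1, z.2])).ne_zero hz
    simp [this]
  | mul a i ha hi ih =>
    have hset : {z : ℝ × ℝ | eval ![z.1, z.2] (i * a) = 0} =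
        {z : ℝ × ℝ | eval ![z.1, z.2] i = 0} ∪ {z : ℝ × ℝ | eval ![z.1, z.2] a = 0} := by
      ext z
      simp
    rw [hset, Metric.cthickening_union, inter_union_distrib_left,
      totalDegree_mul_of_isDomain hi.ne_zero ha]
    refine (measure_union_le _ _).trans ((add_le_add
      (volume_ball_inter_cthickening_le_of_irreducible hi hρ hR x₀) (ih ha)).trans ?_)
    rw [← ENNReal.ofReal_add (by positivity) (by positivity)]
    refine ENNReal.ofReal_le_ofReal (le_of_eq ?_)
    push_cast
    ring

/-- **Wongkew's theorem in the plane** (Theorem 5.3 of the paper): there is an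
absolute constant `C` such that for every nonzero polynomial `F` in two real
variables of degree at most `D` (`D ≥ 1`), every `ρ > 0`, every `R > 0` and every
ball of radius `R` in `ℝ²`, the area of the intersection of the ball with the
closed `ρ`-neighborhood of the zero set `Z(F)` is at most `C·D·ρ·R`. -/
theorem wongkew_plane :
    ∃ C : ℝ, ∀ D : ℕ, 1 ≤ D → ∀ F : MvPolynomial (Fin 2) ℝ, F ≠ 0 →
      F.totalDegree ≤ D → ∀ ρ : ℝ, 0 < ρ → ∀ R : ℝ, 0 < R → ∀ x₀ : ℝ × ℝ,
      volume (Metric.ball x₀ R ∩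
          Metric.cthickening ρ {z : ℝ × ℝ | eval ![z.1, z.2] F = 0}) ≤
        ENNReal.ofReal (C * D * ρ * R) := by
  refine ⟨2000, fun D _ F hF hFD ρ hρ R hR x₀ =>
    (volume_ball_inter_cthickening_le hF hρ hR x₀).trans (ENNReal.ofReal_le_ofReal ?_)⟩
  gcongr
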